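/- arXiv:1505.04040 — 2 statements merged into one kernel-verified Lean document; each statement's English description precedes it below -/
import Mathlib

section
/- For τ in the upper half-plane, G̃_{2,4}(τ) = G₆(τ) + (π²/(3τ²)) G₄(τ) + (4π⁴/(45τ⁴)) G₂(τ) − 2π⁶/(63τ⁶). -/
open Real

/-- The Eisenstein series `G_k(τ)` (iterated summation, inner over `n`). -/
noncomputable def G (k : ℕ) (τ : ℂ) : ℂ :=
  ∑' m : ℤ, ∑' n : ℤ, if m = 0 ∧ n = 0 then 0 else 1 / ((m : ℂ) + n * τ) ^ k

/-- The double Eisenstein-type series `G̃_{2p,2q}(τ)`. -/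
noncomputable def tildeG (p q : ℕ) (τ : ℂ) : ℂ :=
  ∑' m : ℤ, ∑' n₁ : ℤ, ∑' n₂ : ℤ,
    if (m = 0 ∧ n₁ = 0) ∨ (m = 0 ∧ n₂ = 0) then 0
    else 1 / (((m : ℂ) + n₁ * τ) ^ (2 * p) * ((m : ℂ) + n₂ * τ) ^ (2 * q))

open Complex (I) in
lemma aux_inner (τ : ℂ) (hτ : 0 < τ.im) (k : ℕ) (hk : 1 ≤ k) (he : Even (k + 1)) (m : ℤ)
    (hm : m ≠ 0) :
    ∑' n : ℤ, 1 / ((m : ℂ) + n * τ) ^ (k + 1) =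
      1 / τ ^ (k + 1) * (((-2 * π * I) ^ (k + 1) / (k.factorial : ℂ)) *
        ∑' n : ℕ, (n : ℂ) ^ k * (Complex.exp (2 * π * I * (-1 / τ)) ^ m.natAbs) ^ n) := by
  have hτ0 : τ ≠ 0 := by rintro rfl; simp at hτ
  have him : 0 < (-1 / τ).im := by
    rw [neg_div, one_div, Complex.neg_im, Complex.inv_im, neg_div, neg_neg]
    exact div_pos hτ (Complex.normSq_pos.mpr hτ0)
  have hpos : 0 < m.natAbs := Int.natAbs_pos.mpr hm
  have hz : 0 < ((m.natAbs : ℂ) * (-1 / τ)).im := by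
    rw [← Complex.ofReal_natCast, Complex.im_ofReal_mul]
    exact mul_pos (by exact_mod_cast hpos) him
  have H := EisensteinSeries.qExpansion_identity hk ⟨_, hz⟩
  simp only at H
  have hexp : Complex.exp (2 * π * I * ((m.natAbs : ℂ) * (-1 / τ))) =
      Complex.exp (2 * π * I * (-1 / τ)) ^ m.natAbs := by
    rw [← Complex.exp_nat_mul]; ring_nf
  rw [hexp] at H
  rw [← H, ← tsum_mul_left]
  rcases lt_or_gt_of_ne hm with h | h
  · have hc : (m.natAbs : ℂ) = -m := by
      rw [← Int.cast_natCast, Int.natCast_natAbs, abs_of_neg h]; push_cast; rfl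
    refine tsum_congr fun n => ?_
    rw [hc, div_mul_div_comm, ← mul_pow]
    congr 2
    · ring
    · field_simp
  · have hc : (m.natAbs : ℂ) = m := by
      rw [← Int.cast_natCast, Int.natCast_natAbs, abs_of_pos h]
    rw [← (Equiv.neg ℤ).tsum_eq]
    refine tsum_congr fun n => ?_
    rw [hc, div_mul_div_comm, ← mul_pow, ← he.neg_pow]
    congr 2
    · ring
    · simp only [Equiv.neg_apply]; push_cast; field_simp; ring

lemma cast_ch (n k : ℕ) : (((n + k).choose k : ℕ) : ℂ) =
    ((n + 1).ascFactorial k : ℕ) / (k.factorial : ℂ) := by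
  rw [Nat.ascFactorial_eq_factorial_mul_choose]
  have : (k.factorial : ℂ) ≠ 0 := by exact_mod_cast k.factorial_ne_zero
  push_cast; field_simp

lemma one_sub_ne {q : ℂ} (hq : ‖q‖ < 1) : 1 - q ≠ 0 := by
  intro h
  rw [← sub_eq_zero.mp h] at hq; simp at hq

lemma sum_three {q : ℂ} (hq : ‖q‖ < 1) : ∑' n : ℕ, (n : ℂ) ^ 3 * q ^ n =
    q * (1 + 4 * q + q ^ 2) / (1 - q) ^ 4 := by
  have h (k) := hasSum_choose_mul_geometric_of_norm_lt_one k hq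
  have := (((h 3).mul_left 6).sub ((h 2).mul_left 12)).add (((h 1).mul_left 7).sub (h 0))
  have h1 := one_sub_ne hq
  refine (this.congr_fun fun n => ?_).tsum_eq.trans ?_
  · simp only [cast_ch, Nat.ascFactorial, Nat.factorial]; push_cast; ring
  · field_simp; ring

lemma sum_five {q : ℂ} (hq : ‖q‖ < 1) : ∑' n : ℕ, (n : ℂ) ^ 5 * q ^ n =
    q * (1 + 26 * q + 66 * q ^ 2 + 26 * q ^ 3 + q ^ 4) / (1 - q) ^ 6 := by
  have h (k) := hasSum_choose_mul_geometric_of_norm_lt_one k hq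
  have := ((((h 5).mul_left 120).sub ((h 4).mul_left 360)).add
    (((h 3).mul_left 390).sub ((h 2).mul_left 180))).add (((h 1).mul_left 31).sub (h 0))
  have h1 := one_sub_ne hq
  refine (this.congr_fun fun n => ?_).tsum_eq.trans ?_
  · simp only [cast_ch, Nat.ascFactorial, Nat.factorial]; push_cast; ring
  · field_simp; ring

lemma b_six : bernoulli 6 = 1 / 42 := by
  have h5 : bernoulli' 5 = 0 := bernoulli'_eq_zero_of_odd (by decide) (by norm_num)
  rw [bernoulli_eq_bernoulli'_of_ne_one (by norm_num), bernoulli'_def]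
  norm_num [Finset.sum_range_succ, h5, bernoulli'_four,
    show Nat.choose 6 2 = 15 by decide, show Nat.choose 6 4 = 15 by decide]

lemma zeta_six : riemannZeta 6 = (π : ℂ) ^ 6 / 945 := by
  have := riemannZeta_two_mul_nat (k := 3) (by norm_num)
  norm_num [b_six, Nat.factorial] at this
  rw [this]; ring

lemma zero_inner (τ : ℂ) (k : ℕ) (hk : 2 ≤ k) (he : Even k) :
    ∑' n : ℤ, 1 / (((0 : ℤ) : ℂ) + n * τ) ^ k = 2 * riemannZeta k / τ ^ k := by
  rw [two_mul_riemannZeta_eq_tsum_int_inv_pow_of_even hk he, div_eq_mul_inv, ← tsum_mul_right]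
  refine tsum_congr fun n => ?_
  simp [mul_pow, mul_comm]

noncomputable def aIn (k : ℕ) (τ : ℂ) (m : ℤ) : ℂ := ∑' n : ℤ, 1 / ((m : ℂ) + n * τ) ^ k

lemma G_eq (k : ℕ) (hk : k ≠ 0) (τ : ℂ) : G k τ = ∑' m : ℤ, aIn k τ m := by
  unfold G aIn
  refine tsum_congr fun m => tsum_congr fun n => ?_
  split_ifs with h
  · simp [h.1, h.2, hk]
  · rfl

lemma tildeG_eq (τ : ℂ) : tildeG 1 2 τ = ∑' m : ℤ, aIn 2 τ m * aIn 4 τ m := by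
  unfold tildeG aIn
  refine tsum_congr fun m => ?_
  rw [← tsum_mul_right]
  refine tsum_congr fun n => ?_
  rw [← tsum_mul_left]
  refine tsum_congr fun n' => ?_
  split_ifs with h
  · rcases h with h | h <;> simp [h.1, h.2]
  · rw [div_mul_div_comm]; simp

noncomputable def qq (τ : ℂ) (m : ℤ) : ℂ :=
  Complex.exp (2 * π * Complex.I * (-1 / τ)) ^ m.natAbs

lemma norm_q (τ : ℂ) (hτ : 0 < τ.im) : ‖Complex.exp (2 * π * Complex.I * (-1 / τ))‖ < 1 := by
  have hτ0 : τ ≠ 0 := by rintro rfl; simp at hτ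
  have him : 0 < (-1 / τ).im := by
    rw [neg_div, one_div, Complex.neg_im, Complex.inv_im, neg_div, neg_neg]
    exact div_pos hτ (Complex.normSq_pos.mpr hτ0)
  exact UpperHalfPlane.norm_exp_two_pi_I_lt_one ⟨_, him⟩

lemma norm_qq (τ : ℂ) (hτ : 0 < τ.im) (m : ℤ) (hm : m ≠ 0) : ‖qq τ m‖ < 1 := by
  rw [qq, norm_pow]
  exact pow_lt_one₀ (norm_nonneg _) (norm_q τ hτ) (Int.natAbs_ne_zero.mpr hm)

lemma qq_summable (τ : ℂ) (hτ : 0 < τ.im) : Summable (qq τ) := by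
  have := summable_geometric_of_norm_lt_one (norm_q τ hτ)
  exact Summable.of_nat_of_neg (by simpa [qq] using this) (by simpa [qq] using this)

lemma I_six : Complex.I ^ 6 = -1 := by
  rw [show 6 = 4 + 2 from rfl, pow_add, Complex.I_pow_four, Complex.I_sq]; ring

lemma a_two (τ : ℂ) (hτ : 0 < τ.im) (m : ℤ) (hm : m ≠ 0) :
    aIn 2 τ m = qq τ m * (-4 * π ^ 2 / τ ^ 2 / (1 - qq τ m) ^ 2) := by
  have h := aux_inner τ hτ 1 le_rfl (by decide) m hm
  have h' := tsum_coe_mul_geometric_of_norm_lt_one (norm_qq τ hτ m hm)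
  rw [qq] at h' ⊢
  simp only [pow_one] at h
  rw [h'] at h
  rw [aIn, h]
  simp only [mul_pow, Nat.reduceAdd, Complex.I_sq, Nat.factorial]
  push_cast; ring

lemma a_four (τ : ℂ) (hτ : 0 < τ.im) (m : ℤ) (hm : m ≠ 0) :
    aIn 4 τ m = qq τ m * (8 * π ^ 4 / (3 * τ ^ 4) * (1 + 4 * qq τ m + qq τ m ^ 2)
      / (1 - qq τ m) ^ 4) := by
  have h := aux_inner τ hτ 3 (by norm_num) (by decide) m hm
  have h' := sum_three (norm_qq τ hτ m hm)
  rw [qq] at h' ⊢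
  rw [h'] at h
  rw [aIn, h]
  simp only [mul_pow, Nat.reduceAdd, Complex.I_pow_four, Nat.factorial]
  push_cast; ring

lemma a_six (τ : ℂ) (hτ : 0 < τ.im) (m : ℤ) (hm : m ≠ 0) :
    aIn 6 τ m = qq τ m * (-8 * π ^ 6 / (15 * τ ^ 6) *
      (1 + 26 * qq τ m + 66 * qq τ m ^ 2 + 26 * qq τ m ^ 3 + qq τ m ^ 4)
      / (1 - qq τ m) ^ 6) := by
  have h := aux_inner τ hτ 5 (by norm_num) (by decide) m hm
  have h' := sum_five (norm_qq τ hτ m hm)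
  rw [qq] at h' ⊢
  rw [h'] at h
  rw [aIn, h]
  simp only [mul_pow, Nat.reduceAdd, I_six, Nat.factorial]
  push_cast; ring

lemma key (τ : ℂ) (hτ : 0 < τ.im) (m : ℤ) :
    aIn 2 τ m * aIn 4 τ m = aIn 6 τ m + (π : ℂ) ^ 2 / (3 * τ ^ 2) * aIn 4 τ m +
      4 * (π : ℂ) ^ 4 / (45 * τ ^ 4) * aIn 2 τ m
      - (if m = 0 then 2 * (π : ℂ) ^ 6 / (63 * τ ^ 6) else 0) := by
  have hτ0 : τ ≠ 0 := by rintro rfl; simp at hτ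
  by_cases hm : m = 0
  · subst hm
    have h2 : aIn 2 τ 0 = _ := zero_inner τ 2 le_rfl (by decide)
    have h4 : aIn 4 τ 0 = _ := zero_inner τ 4 (by norm_num) (by decide)
    have h6 : aIn 6 τ 0 = _ := zero_inner τ 6 (by norm_num) (by decide)
    push_cast at h2 h4 h6
    rw [h2, h4, h6, riemannZeta_two, riemannZeta_four, zeta_six, if_pos rfl]
    field_simp; ring
  · rw [a_two τ hτ m hm, a_four τ hτ m hm, a_six τ hτ m hm, if_neg hm]
    have := one_sub_ne (norm_qq τ hτ m hm)
    generalize qq τ m = q at *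
    field_simp; ring

lemma summable_aux (τ : ℂ) (hτ : 0 < τ.im) (g : ℂ → ℂ) (hg : ContinuousAt g 0) (f : ℤ → ℂ)
    (hf : ∀ m ≠ 0, f m = qq τ m * g (qq τ m)) : Summable f := by
  have hs := qq_summable τ hτ
  have hb := (hg.tendsto.comp hs.tendsto_cofinite_zero).isBigO_one ℝ
  refine summable_of_isBigO hs.norm ?_
  have h2 : f =ᶠ[Filter.cofinite] fun m => qq τ m * (g ∘ qq τ) m := by
    filter_upwards [(Set.finite_singleton (0 : ℤ)).compl_mem_cofinite] with m hm
    exact hf m hm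
  refine h2.trans_isBigO ?_
  refine ((Asymptotics.isBigO_refl (qq τ) Filter.cofinite).norm_right.mul hb).congr_right ?_
  intro m; simp

lemma aIn_summable (τ : ℂ) (hτ : 0 < τ.im) (k : ℕ) (hk : k = 2 ∨ k = 4 ∨ k = 6) :
    Summable (aIn k τ) := by
  rcases hk with rfl | rfl | rfl
  · exact summable_aux τ hτ (fun q => -4 * π ^ 2 / τ ^ 2 / (1 - q) ^ 2)
      (ContinuousAt.div (by fun_prop) (by fun_prop) (by simp)) _ (a_two τ hτ)
  · exact summable_aux τ hτ
      (fun q => 8 * π ^ 4 / (3 * τ ^ 4) * (1 + 4 * q + q ^ 2) / (1 - q) ^ 4)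
      (ContinuousAt.div (by fun_prop) (by fun_prop) (by simp)) _ (a_four τ hτ)
  · exact summable_aux τ hτ (fun q => -8 * π ^ 6 / (15 * τ ^ 6) *
      (1 + 26 * q + 66 * q ^ 2 + 26 * q ^ 3 + q ^ 4) / (1 - q) ^ 6)
      (ContinuousAt.div (by fun_prop) (by fun_prop) (by simp)) _ (a_six τ hτ)

theorem tildeG_two_four (τ : ℂ) (hτ : 0 < τ.im) :
    tildeG 1 2 τ = G 6 τ + (π : ℂ) ^ 2 / (3 * τ ^ 2) * G 4 τ +
      4 * (π : ℂ) ^ 4 / (45 * τ ^ 4) * G 2 τ - 2 * (π : ℂ) ^ 6 / (63 * τ ^ 6) := by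
  rw [tildeG_eq, G_eq 6 (by norm_num), G_eq 4 (by norm_num), G_eq 2 (by norm_num)]
  have h2 := (aIn_summable τ hτ 2 (by simp)).hasSum
  have h4 := (aIn_summable τ hτ 4 (by simp)).hasSum
  have h6 := (aIn_summable τ hτ 6 (by simp)).hasSum
  have := ((h6.add (h4.mul_left ((π : ℂ) ^ 2 / (3 * τ ^ 2)))).add
    (h2.mul_left (4 * (π : ℂ) ^ 4 / (45 * τ ^ 4)))).sub
    (hasSum_ite_eq (0 : ℤ) (2 * (π : ℂ) ^ 6 / (63 * τ ^ 6)))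
  rw [← this.tsum_eq]
  exact tsum_congr fun m => key τ hτ m
end

section
/- For p,q ≥ 1 with (p,q) ≠ (1,1), and τ in the upper half-plane, the quantity τ^{2(p+q)} G̃_{2p,2q}(τ) lies in the ℚ-algebra generated by τ², π², G₂(τ), G₄(τ), and G₆(τ); that is, there is a polynomial with rational coefficients P such that τ^{2(p+q)} G̃_{2p,2q}(τ) = P(τ², π², G₂(τ), G₄(τ), G₆(τ)). -/
open Real

section Formal

open PowerSeries

/-- the derivation `q d/dq` -/
noncomputable def thetaD : Derivation ℚ ℚ⟦X⟧ ℚ⟦X⟧ := (X : ℚ⟦X⟧) • PowerSeries.derivative ℚ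

noncomputable def PP (k : ℕ) : ℚ⟦X⟧ := PowerSeries.mk fun n => (n : ℚ) ^ k

lemma coeff_thetaD (f : ℚ⟦X⟧) (n : ℕ) : coeff n (thetaD f) = n * coeff n f := by
  cases n with
  | zero => simp [thetaD]
  | succ n =>
    simp [thetaD, PowerSeries.coeff_succ_X_mul, PowerSeries.coeff_derivative]
    ring

lemma thetaD_PP (k : ℕ) : thetaD (PP k) = PP (k + 1) := by
  ext n
  simp [coeff_thetaD, PP, pow_succ']

lemma thetaD_PP_zero : thetaD (PP 0) = PP 0 ^ 2 - PP 0 := by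
  ext n
  simp [coeff_thetaD, PP, pow_two, PowerSeries.coeff_mul]

lemma PP_one : PP 1 = PP 0 ^ 2 - PP 0 := by
  rw [← thetaD_PP_zero, thetaD_PP]

lemma thetaD_PP_one : thetaD (PP 1) = (2 * PP 0 - 1) * PP 1 := by
  rw [PP_one, map_sub, Derivation.leibniz_pow, thetaD_PP_zero]
  simp
  ring

lemma thetaD_sq_pow (j : ℕ) : thetaD (thetaD (PP 1 ^ (j + 1))) =
    ((j + 1 : ℚ) ^ 2) • PP 1 ^ (j + 1) + (2 * (j + 1) * (2 * (j + 1) + 1) : ℚ) • PP 1 ^ (j + 2) := by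
  have h1 : thetaD (PP 1 ^ (j + 1)) = ((j + 1 : ℚ)) • ((2 * PP 0 - 1) * PP 1 ^ (j + 1)) := by
    rw [Derivation.leibniz_pow, thetaD_PP_one]
    simp only [Nat.add_sub_cancel, smul_eq_mul, nsmul_eq_mul, PowerSeries.smul_eq_C_mul]
    push_cast
    simp only [map_add, map_natCast, map_one]
    ring
  rw [h1, Derivation.map_smul, Derivation.leibniz, h1, map_sub, Derivation.leibniz, thetaD_PP_zero]
  have h2 : thetaD (2 : ℚ⟦X⟧) = 0 := by
    simpa using thetaD.map_natCast 2
  have h4 : thetaD (1 : ℚ⟦X⟧) = 0 := by simp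
  rw [h2, h4]
  simp only [smul_eq_mul, PowerSeries.smul_eq_C_mul]
  have h3 : PP 1 ^ (j+2) = (PP 0 ^ 2 - PP 0) * PP 1 ^ (j + 1) := by rw [← PP_one]; ring
  rw [h3]
  have hC : (C 2 : ℚ⟦X⟧) = 2 := map_ofNat C 2
  simp only [map_add, map_natCast, map_one, map_mul, map_pow, hC]
  rw [PP_one]
  ring

noncomputable def UU (d : ℕ) : Submodule ℚ ℚ⟦X⟧ :=
  Submodule.span ℚ ((fun j => PP 1 ^ (j + 1)) '' Set.Iio d)
noncomputable def VV (d : ℕ) : Submodule ℚ ℚ⟦X⟧ :=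
  Submodule.span ℚ ((fun j => PP (2 * j + 1)) '' Set.Iio d)

lemma UU_mono {a b : ℕ} (h : a ≤ b) : UU a ≤ UU b :=
  Submodule.span_mono (Set.image_mono (Set.Iio_subset_Iio h))
lemma VV_mono {a b : ℕ} (h : a ≤ b) : VV a ≤ VV b :=
  Submodule.span_mono (Set.image_mono (Set.Iio_subset_Iio h))
lemma mem_UU {j d : ℕ} (h : j < d) : PP 1 ^ (j + 1) ∈ UU d :=
  Submodule.subset_span ⟨j, h, rfl⟩
lemma mem_VV {j d : ℕ} (h : j < d) : PP (2 * j + 1) ∈ VV d :=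
  Submodule.subset_span ⟨j, h, rfl⟩

lemma theta_UU {d : ℕ} {f : ℚ⟦X⟧} (hf : f ∈ UU d) : thetaD (thetaD f) ∈ UU (d + 1) := by
  induction hf using Submodule.span_induction with
  | mem x hx =>
    obtain ⟨j, hj, rfl⟩ := hx
    have hj : j < d := hj
    simp only [thetaD_sq_pow]
    exact add_mem (Submodule.smul_mem _ _ (mem_UU (by omega)))
      (Submodule.smul_mem _ _ (mem_UU (j := j + 1) (by omega)))
  | zero => simp
  | add x y _ _ hx hy => simpa using add_mem hx hy
  | smul a x _ hx => simpa using Submodule.smul_mem _ a hx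

lemma theta_VV {d : ℕ} {f : ℚ⟦X⟧} (hf : f ∈ VV d) : thetaD (thetaD f) ∈ VV (d + 1) := by
  induction hf using Submodule.span_induction with
  | mem x hx =>
    obtain ⟨j, hj, rfl⟩ := hx
    have hj : j < d := hj
    simp only [thetaD_PP]
    exact mem_VV (j := j + 1) (by omega)
  | zero => simp
  | add x y _ _ hx hy => simpa using add_mem hx hy
  | smul a x _ hx => simpa using Submodule.smul_mem _ a hx

lemma PP_mem_UU (k : ℕ) : PP (2 * k + 1) ∈ UU (k + 1) := by
  induction k with
  | zero => simpa using mem_UU (j := 0) (d := 1) (by omega)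
  | succ k ih =>
    have := theta_UU ih
    rwa [thetaD_PP, thetaD_PP] at this

lemma pow_mem_VV (j : ℕ) : PP 1 ^ (j + 1) ∈ VV (j + 1) := by
  induction j with
  | zero => simpa using mem_VV (j := 0) (d := 1) (by omega)
  | succ j ih =>
    have h := theta_VV ih
    rw [thetaD_sq_pow] at h
    have h2 := (Submodule.add_mem_iff_right _ (Submodule.smul_mem _ _ (VV_mono (by omega) ih))).1 h
    have h0 : (2 * (j + 1) * (2 * (j + 1) + 1) : ℚ) ≠ 0 := by positivity
    exact (Submodule.smul_mem_iff _ h0).1 h2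

lemma UU_le_VV (d : ℕ) : UU d ≤ VV d := by
  refine Submodule.span_le.2 ?_
  rintro _ ⟨j, hj, rfl⟩
  have hj : j < d := hj
  exact VV_mono (by omega) (pow_mem_VV j)

lemma UU_mul {a b : ℕ} {f g : ℚ⟦X⟧} (hf : f ∈ UU a) (hg : g ∈ UU b) : f * g ∈ UU (a + b) := by
  have := Submodule.mul_mem_mul hf hg
  rw [UU, UU, Submodule.span_mul_span] at this
  refine (Submodule.span_le.2 ?_) this
  rintro _ ⟨_, ⟨i, hi, rfl⟩, _, ⟨j, hj, rfl⟩, rfl⟩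
  have hi : i < a := hi
  have hj : j < b := hj
  have : PP 1 ^ (i + 1) * PP 1 ^ (j + 1) = PP 1 ^ (i + j + 1 + 1) := by ring
  simp only [this]
  exact mem_UU (by omega)

lemma PP_mul (a b : ℕ) : ∃ c : ℕ → ℚ, PP (2 * a + 1) * PP (2 * b + 1) =
    ∑ i ∈ Finset.range (a + b + 2), c i • PP (2 * i + 1) := by
  have h := UU_le_VV _ (UU_mul (PP_mem_UU a) (PP_mem_UU b))
  rw [VV, ← Finset.coe_Iio, Submodule.mem_span_image_finset_iff_exists_fun] at h
  obtain ⟨c, hc⟩ := h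
  refine ⟨fun i => if h : i ∈ Finset.Iio (a + 1 + (b + 1)) then c ⟨i, h⟩ else 0, ?_⟩
  have hI : Finset.range (a + b + 2) = Finset.Iio (a + 1 + (b + 1)) := by
    ext; simp; omega
  rw [← hc, hI, ← Finset.sum_coe_sort (Finset.Iio (a + 1 + (b + 1)))]
  refine Finset.sum_congr rfl fun i _ => ?_
  dsimp only
  rw [dif_pos i.2]

lemma PP_coeff_mul (a b : ℕ) : ∃ c : ℕ → ℚ, ∀ n : ℕ,
    ∑ p ∈ Finset.HasAntidiagonal.antidiagonal n, (p.1 : ℚ) ^ (2 * a + 1) * (p.2 : ℚ) ^ (2 * b + 1) =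
    ∑ i ∈ Finset.range (a + b + 2), c i * (n : ℚ) ^ (2 * i + 1) := by
  obtain ⟨c, hc⟩ := PP_mul a b
  refine ⟨c, fun n => ?_⟩
  have := congrArg (coeff n) hc
  simpa [PowerSeries.coeff_mul, PP] using this

end Formal

section Analytic

noncomputable def EE (j : ℕ) (r : ℂ) : ℂ := ∑' n : ℕ, (n : ℂ) ^ (2 * j + 1) * r ^ n

lemma EE_mul (a b : ℕ) : ∃ c : ℕ → ℚ, ∀ r : ℂ, ‖r‖ < 1 →
    EE a r * EE b r = ∑ i ∈ Finset.range (a + b + 2), (c i : ℂ) * EE i r := by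
  obtain ⟨c, hc⟩ := PP_coeff_mul a b
  refine ⟨c, fun r hr => ?_⟩
  have hs (j : ℕ) := summable_norm_pow_mul_geometric_of_norm_lt_one (R := ℂ) j hr
  rw [EE, EE, tsum_mul_tsum_eq_tsum_sum_antidiagonal_of_summable_norm (hs _) (hs _)]
  simp only [EE, ← tsum_mul_left]
  rw [← Summable.tsum_finsetSum (fun i _ => ((hs (2 * i + 1)).of_norm).mul_left _)]
  refine tsum_congr fun n => ?_
  have h := congrArg (fun x : ℚ => (x : ℂ) * r ^ n) (hc n)
  push_cast at h
  rw [Finset.sum_mul, Finset.sum_mul] at h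
  simp only [← mul_assoc]
  rw [← h]
  refine Finset.sum_congr rfl fun p hp => ?_
  rw [← Finset.HasAntidiagonal.mem_antidiagonal.1 hp, pow_add]
  ring

noncomputable def TT (k : ℕ) (τ : ℂ) (m : ℤ) : ℂ := ∑' n : ℤ, 1 / ((m : ℂ) + n * τ) ^ k

lemma G_eq_TT {k : ℕ} (hk : k ≠ 0) (τ : ℂ) : G k τ = ∑' m : ℤ, TT k τ m := by
  unfold G TT
  refine tsum_congr fun m => tsum_congr fun n => ?_
  split_ifs with h
  · simp [h.1, h.2, hk]
  · rfl

lemma tildeG_eq_TT {p q : ℕ} (hp : 1 ≤ p) (hq : 1 ≤ q) (τ : ℂ) :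
    tildeG p q τ = ∑' m : ℤ, TT (2 * p) τ m * TT (2 * q) τ m := by
  unfold tildeG TT
  refine tsum_congr fun m => ?_
  rw [← tsum_mul_right]
  refine tsum_congr fun n => ?_
  rw [← tsum_mul_left]
  refine tsum_congr fun n' => ?_
  have hp' : 2 * p ≠ 0 := by omega
  have hq' : 2 * q ≠ 0 := by omega
  split_ifs with h
  · rcases h with h | h
    · simp [h.1, h.2, hp']
    · simp [h.1, h.2, hq']
  · rw [one_div_mul_one_div]

noncomputable def KK (j : ℕ) : ℂ := (-4 * (π : ℂ) ^ 2) ^ (j + 1) / (2 * j + 1).factorial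

noncomputable def QQ (τ : ℂ) : ℂ := Complex.exp (2 * π * Complex.I * (-1 / τ))

lemma neg_inv_im {τ : ℂ} (hτ : 0 < τ.im) : 0 < (-1 / τ).im := by
  have h0 : 0 < Complex.normSq τ := Complex.normSq_pos.2 (by rintro rfl; simp at hτ)
  have : (-1 / τ).im = τ.im / Complex.normSq τ := by
    rw [Complex.div_im]
    simp
    ring
  rw [this]
  positivity

lemma QQ_norm {τ : ℂ} (hτ : 0 < τ.im) : ‖QQ τ‖ < 1 :=
  UpperHalfPlane.norm_exp_two_pi_I_lt_one ⟨-1 / τ, neg_inv_im hτ⟩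

lemma TT_neg (j : ℕ) (τ : ℂ) (m : ℤ) : TT (2 * j + 2) τ (-m) = TT (2 * j + 2) τ m := by
  unfold TT
  rw [← (Equiv.neg ℤ).tsum_eq]
  refine tsum_congr fun n => ?_
  have : ((-m : ℤ) : ℂ) + ((Equiv.neg ℤ n : ℤ) : ℂ) * τ = - (m + n * τ) := by
    simp; ring
  rw [this, Even.neg_pow ⟨j + 1, by ring⟩]

lemma TT_pos (j : ℕ) {τ : ℂ} (hτ : 0 < τ.im) (N : ℕ) (hN : 0 < N) :
    τ ^ (2 * j + 2) * TT (2 * j + 2) τ (-(N : ℤ)) = KK j * EE j (QQ τ ^ N) := by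
  have h0 : τ ≠ 0 := by rintro rfl; simp at hτ
  have him : 0 < ((N : ℂ) * (-1 / τ)).im := by
    have := neg_inv_im hτ
    rw [← Complex.ofReal_natCast, Complex.im_ofReal_mul]
    positivity
  have h := EisensteinSeries.qExpansion_identity (k := 2 * j + 1) (by omega)
    ⟨(N : ℂ) * (-1 / τ), him⟩
  rw [TT, ← tsum_mul_left]
  have e : ∀ n : ℤ, τ ^ (2 * j + 2) * (1 / (((-(N : ℤ) : ℤ) : ℂ) + n * τ) ^ (2 * j + 2)) =
      1 / ((N : ℂ) * (-1 / τ) + n) ^ (2 * j + 1 + 1) := by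
    intro n
    have : (((-(N : ℤ) : ℤ) : ℂ) + n * τ) = τ * ((N : ℂ) * (-1 / τ) + n) := by
      push_cast; field_simp
    rw [this, mul_pow, one_div, mul_inv, ← mul_assoc, mul_inv_cancel₀ (pow_ne_zero _ h0), one_mul,
      one_div]
  simp only [e]
  refine h.trans ?_
  rw [KK, EE]
  congr 1
  · congr 1
    rw [show 2 * j + 1 + 1 = 2 * (j + 1) by ring, pow_mul]
    congr 1
    ring_nf
    simp
  · refine tsum_congr fun n => ?_
    congr 2
    rw [QQ, ← Complex.exp_nat_mul]
    congr 1
    simp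
    ring

noncomputable def ee (j : ℕ) (τ : ℂ) (m : ℤ) : ℂ := if m = 0 then 0 else EE j (QQ τ ^ m.natAbs)

noncomputable def ZZ (k : ℕ) : ℂ := ∑' n : ℤ, 1 / (n : ℂ) ^ k

lemma TT_eq (j : ℕ) {τ : ℂ} (hτ : 0 < τ.im) (m : ℤ) :
    τ ^ (2 * j + 2) * TT (2 * j + 2) τ m =
      (if m = 0 then ZZ (2 * j + 2) else 0) + KK j * ee j τ m := by
  have h0 : τ ≠ 0 := by rintro rfl; simp at hτ
  by_cases hm : m = 0
  · subst hm
    simp only [if_true, ee, mul_zero, add_zero, TT, ZZ, ← tsum_mul_left]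
    refine tsum_congr fun n => ?_
    have := pow_ne_zero (2 * j + 2) h0
    simp only [Int.cast_zero, zero_add, mul_pow, one_div, mul_inv]
    field_simp
  · simp only [ee, if_neg hm, zero_add]
    rw [← TT_pos j hτ m.natAbs (by omega)]
    congr 1
    rcases Int.natAbs_eq m with h | h
    · conv_lhs => rw [h, ← TT_neg]
    · conv_lhs => rw [h]

lemma ee_summable (j : ℕ) {τ : ℂ} (hτ : 0 < τ.im) : Summable (ee j τ) := by
  have h := (summable_prod_mul_pow (2 * j + 1) (QQ_norm hτ)).prod
  have h2 : Summable fun m : ℕ+ => EE j (QQ τ ^ (m : ℕ)) := by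
    refine h.congr fun m => ?_
    rw [EE, ← tsum_zero_pnat_eq_tsum_nat]
    · simp [pow_mul]
    · refine (summable_norm_pow_mul_geometric_of_norm_lt_one (R := ℂ) (2 * j + 1) ?_).of_norm
      rw [norm_pow]
      exact pow_lt_one₀ (norm_nonneg _) (QQ_norm hτ) m.ne_zero
  have h3 : Summable fun m : ℕ => ee j τ (m : ℤ) := by
    rw [← summable_nat_add_iff 1]
    rw [← Equiv.pnatEquivNat.symm.summable_iff] at h2
    refine h2.congr fun n => ?_
    have hn : ((n : ℤ) + 1) ≠ 0 := by omega
    have hn' : ((n : ℤ) + 1).natAbs = n + 1 := by omega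
    simp [ee, hn, hn']
  refine Summable.of_nat_of_neg h3 ?_
  simpa [ee] using h3

lemma ee_mul (a b : ℕ) : ∃ c : ℕ → ℚ, ∀ τ : ℂ, 0 < τ.im → ∀ m : ℤ,
    ee a τ m * ee b τ m = ∑ i ∈ Finset.range (a + b + 2), (c i : ℂ) * ee i τ m := by
  obtain ⟨c, hc⟩ := EE_mul a b
  refine ⟨c, fun τ hτ m => ?_⟩
  by_cases hm : m = 0
  · simp [ee, hm]
  · simp only [ee, if_neg hm]
    apply hc
    rw [norm_pow]
    exact pow_lt_one₀ (norm_nonneg _) (QQ_norm hτ) (by omega)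

lemma G_eq_s15 (j : ℕ) {τ : ℂ} (hτ : 0 < τ.im) :
    KK j * ∑' m, ee j τ m = τ ^ (2 * j + 2) * G (2 * j + 2) τ - ZZ (2 * j + 2) := by
  rw [G_eq_TT (by omega), ← tsum_mul_left, ← tsum_mul_left]
  simp only [TT_eq j hτ]
  rw [Summable.tsum_add, tsum_ite_eq]
  · ring
  · exact (hasSum_ite_eq 0 _).summable
  · exact (ee_summable j hτ).mul_left _

lemma tildeG_eq_s15 (a b : ℕ) {τ : ℂ} (hτ : 0 < τ.im) : ∃ c : ℕ → ℚ,
    τ ^ (2 * (a + 1 + (b + 1))) * tildeG (a + 1) (b + 1) τ =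
      ZZ (2 * a + 2) * ZZ (2 * b + 2) +
      ∑ i ∈ Finset.range (a + b + 2), (c i : ℂ) * (KK a * KK b) * ∑' m, ee i τ m := by
  obtain ⟨c, hc⟩ := ee_mul a b
  refine ⟨c, ?_⟩
  rw [tildeG_eq_TT (by omega) (by omega), ← tsum_mul_left]
  have e : ∀ m : ℤ, τ ^ (2 * (a + 1 + (b + 1))) * (TT (2 * (a + 1)) τ m * TT (2 * (b + 1)) τ m) =
      (if m = 0 then ZZ (2 * a + 2) * ZZ (2 * b + 2) else 0) +
      ∑ i ∈ Finset.range (a + b + 2), (c i : ℂ) * (KK a * KK b) * ee i τ m := by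
    intro m
    have h1 := TT_eq a hτ m
    have h2 := TT_eq b hτ m
    have h3 : τ ^ (2 * (a + 1 + (b + 1))) * (TT (2 * (a + 1)) τ m * TT (2 * (b + 1)) τ m) =
      (τ ^ (2 * a + 2) * TT (2 * a + 2) τ m) * (τ ^ (2 * b + 2) * TT (2 * b + 2) τ m) := by
      rw [show 2 * (a + 1) = 2 * a + 2 by ring, show 2 * (b + 1) = 2 * b + 2 by ring]
      ring
    have h4 : ∑ i ∈ Finset.range (a + b + 2), (c i : ℂ) * (KK a * KK b) * ee i τ m =
        KK a * KK b * (ee a τ m * ee b τ m) := by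
      rw [hc τ hτ m, Finset.mul_sum]
      exact Finset.sum_congr rfl fun _ _ => by ring
    rw [h3, h1, h2, h4]
    by_cases hm : m = 0
    · simp [hm, ee]
    · simp [hm]; ring
  simp only [e]
  have hs : ∀ i ∈ Finset.range (a + b + 2),
      Summable fun m => (c i : ℂ) * (KK a * KK b) * ee i τ m :=
    fun i _ => (ee_summable i hτ).mul_left _
  rw [Summable.tsum_add, tsum_ite_eq, Summable.tsum_finsetSum hs]
  · simp only [tsum_mul_left]
  · exact (hasSum_ite_eq 0 _).summable
  · exact summable_sum hs

lemma ZZ_eq (j : ℕ) : ∃ c : ℚ, ZZ (2 * j + 2) = c * ((π : ℂ) ^ 2) ^ (j + 1) := by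
  have h := two_mul_riemannZeta_eq_tsum_int_inv_pow_of_even (k := 2 * j + 2) (by omega)
    ⟨j + 1, by ring⟩
  have h2 := riemannZeta_two_mul_nat (k := j + 1) (by omega)
  refine ⟨2 * ((-1) ^ (j + 1 + 1) * 2 ^ (2 * (j + 1) - 1) * bernoulli (2 * (j + 1)) /
    (2 * (j + 1)).factorial), ?_⟩
  have h3 : riemannZeta ((2 * j + 2 : ℕ) : ℂ) = riemannZeta (2 * ((j + 1 : ℕ) : ℂ)) := by
    congr 1; push_cast; ring
  rw [h3, h2] at h
  simp only [ZZ, one_div]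
  rw [← h]
  push_cast
  rw [← pow_mul]
  ring

lemma KK_mul (a b i : ℕ) (hi : i < a + b + 2) : ∃ c : ℚ,
    KK a * KK b = c * ((π : ℂ) ^ 2) ^ (a + b + 1 - i) * KK i := by
  obtain ⟨d, hd⟩ : ∃ d, a + b + 1 = i + d := ⟨a + b + 1 - i, by omega⟩
  refine ⟨(-4) ^ (a + b + 1 - i) * (2 * i + 1).factorial /
    ((2 * a + 1).factorial * (2 * b + 1).factorial), ?_⟩
  have h1 : ((2 * i + 1).factorial : ℂ) ≠ 0 := by exact_mod_cast Nat.factorial_ne_zero _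
  have h2 : ((2 * a + 1).factorial : ℂ) ≠ 0 := by exact_mod_cast Nat.factorial_ne_zero _
  have h3 : ((2 * b + 1).factorial : ℂ) ≠ 0 := by exact_mod_cast Nat.factorial_ne_zero _
  rw [show a + b + 1 - i = d by omega]
  unfold KK
  have e : (-4 * (π : ℂ) ^ 2) ^ (a + 1) * (-4 * (π : ℂ) ^ 2) ^ (b + 1) =
      (-4) ^ d * ((π : ℂ) ^ 2) ^ d * (-4 * (π : ℂ) ^ 2) ^ (i + 1) := by
    rw [← mul_pow, ← pow_add, ← pow_add]
    congr 1; omega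
  push_cast
  rw [div_mul_div_comm, e]
  field_simp

end Analytic

section Weier

open PowerSeries

noncomputable def tay (f : ℂ → ℂ) : ℂ⟦X⟧ :=
  PowerSeries.mk fun n => iteratedDeriv n f 0 / n.factorial

lemma tay_congr {f g : ℂ → ℂ} (h : f =ᶠ[nhds 0] g) : tay f = tay g := by
  ext n
  simp only [tay, coeff_mk, h.iteratedDeriv_eq]

lemma tay_mul {f g : ℂ → ℂ} (hf : AnalyticAt ℂ f 0) (hg : AnalyticAt ℂ g 0) :
    tay (fun z => f z * g z) = tay f * tay g := by
  ext n
  simp only [tay, coeff_mk, PowerSeries.coeff_mul]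
  rw [iteratedDeriv_fun_mul hf.contDiffAt hg.contDiffAt, Finset.Nat.sum_antidiagonal_eq_sum_range_succ_mk,
    Finset.sum_div]
  refine Finset.sum_congr rfl fun i hi => ?_
  have hi' : i ≤ n := by simpa [Nat.lt_succ_iff] using hi
  have h1 : (i.factorial : ℂ) ≠ 0 := by exact_mod_cast Nat.factorial_ne_zero _
  have h2 : ((n - i).factorial : ℂ) ≠ 0 := by exact_mod_cast Nat.factorial_ne_zero _
  have h3 : (n.factorial : ℂ) ≠ 0 := by exact_mod_cast Nat.factorial_ne_zero _
  have h4 : ((n.choose i : ℕ) : ℂ) * i.factorial * (n - i).factorial = n.factorial := by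
    exact_mod_cast Nat.choose_mul_factorial_mul_factorial hi'
  field_simp
  rw [← h4]
  ring

lemma tay_add {f g : ℂ → ℂ} (hf : AnalyticAt ℂ f 0) (hg : AnalyticAt ℂ g 0) :
    tay (fun z => f z + g z) = tay f + tay g := by
  ext n
  simp only [tay, coeff_mk, map_add]
  rw [iteratedDeriv_fun_add hf.contDiffAt hg.contDiffAt, add_div]

lemma tay_const (c : ℂ) : tay (fun _ => c) = C c := by
  ext n
  simp only [tay, coeff_mk, iteratedDeriv_const, PowerSeries.coeff_C]
  split_ifs with h <;> simp [h]

lemma tay_id : tay (fun z => z) = X := by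
  ext n
  simp only [tay, coeff_mk, PowerSeries.coeff_X]
  rcases n with _ | _ | n
  · simp
  · simp [iteratedDeriv_one]
  · have : iteratedDeriv (n + 1 + 1) (fun z : ℂ => z) 0 = 0 := by
      rw [iteratedDeriv_succ', iteratedDeriv_succ']
      simp
    simp [this]

lemma tay_pow {f : ℂ → ℂ} (hf : AnalyticAt ℂ f 0) (k : ℕ) :
    tay (fun z => f z ^ k) = tay f ^ k := by
  induction k with
  | zero => simpa using tay_const 1
  | succ k ih => 
    simp only [pow_succ]
    rw [tay_mul (hf.fun_pow k) hf, ih]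

open PeriodPair in
lemma weier_identity (L : PeriodPair) :
    (fun z : ℂ => (℘'[L - (0 : ℂ)] z * z ^ 3 + (-2)) ^ 2 + (-4) *
      (℘[L - (0 : ℂ)] z * z ^ 2 + 1) ^ 3 + L.g₂ *
      (℘[L - (0 : ℂ)] z * z ^ 6 + z ^ 4) + L.g₃ * z ^ 6) =ᶠ[nhds 0] fun _ => 0 := by
  filter_upwards [L.compl_lattice_sdiff_singleton_mem_nhds _] with z hz
  by_cases hz0 : z = 0
  · simp [hz0]; norm_num
  replace hz : z ∉ L.lattice := by simp_all
  have h := L.derivWeierstrassP_sq z hz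
  have h1 := L.derivWeierstrassPExcept_def 0 z
  have h2 := L.weierstrassPExcept_def 0 z
  simp only [ZeroMemClass.coe_zero] at h1 h2
  rw [h1, h2]
  simp
  field_simp
  linear_combination z ^ 6 * h

noncomputable def gg (L : PeriodPair) (k : ℕ) : ℂ := if k < 3 then 0 else L.G k

noncomputable def UUs (L : PeriodPair) : ℂ⟦X⟧ := PowerSeries.mk fun k => ((k : ℂ) - 1) * gg L k
noncomputable def WWs (L : PeriodPair) : ℂ⟦X⟧ :=
  PowerSeries.mk fun k => ((k : ℂ) - 1) * ((k : ℂ) - 2) * gg L k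

open PeriodPair in
lemma tay_P (L : PeriodPair) : tay ℘[L - (0 : ℂ)] * X ^ 2 = UUs L := by
  ext k
  rw [PowerSeries.coeff_mul_X_pow', UUs, coeff_mk]
  split_ifs with h
  · obtain ⟨n, rfl⟩ := Nat.exists_eq_add_of_le h
    simp only [tay, coeff_mk, Nat.add_sub_cancel_left, iteratedDeriv_weierstrassPExcept_self]
    rcases n with _ | n
    · simp [gg]
    · have h3 : ((n + 1).factorial : ℂ) ≠ 0 := by exact_mod_cast Nat.factorial_ne_zero _
      have h4 : ¬ (2 + (n + 1) < 3) := by omega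
      simp only [gg, h4, if_false, sumInvPow_zero]
      rw [Nat.factorial_succ (n + 1), show n + 1 + 2 = 2 + (n + 1) by ring]
      simp
      field_simp
      ring
  · simp [gg, show k < 3 by omega]

open PeriodPair in
lemma tay_P' (L : PeriodPair) : tay ℘'[L - (0 : ℂ)] * X ^ 3 = WWs L := by
  ext k
  rw [PowerSeries.coeff_mul_X_pow', WWs, coeff_mk]
  split_ifs with h
  · obtain ⟨n, rfl⟩ := Nat.exists_eq_add_of_le h
    simp only [tay, coeff_mk, Nat.add_sub_cancel_left, iteratedDeriv_derivWeierstrassPExcept_self]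
    have h3 : (n.factorial : ℂ) ≠ 0 := by exact_mod_cast Nat.factorial_ne_zero _
    have h4 : ¬ (3 + n < 3) := by omega
    simp only [gg, h4, if_false, sumInvPow_zero]
    rw [Nat.factorial_succ (n + 1), Nat.factorial_succ n, show n + 3 = 3 + n by ring]
    push_cast
    field_simp
    ring
  · simp [gg, show k < 3 by omega]

open PeriodPair in
lemma series_identity (L : PeriodPair) :
    (WWs L - 2) ^ 2 - 4 * (UUs L + 1) ^ 3 + C L.g₂ * (UUs L * X ^ 4 + X ^ 4) + C L.g₃ * X ^ 6 = 0 := by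
  have h := tay_congr (weier_identity L)
  have a1 : AnalyticAt ℂ ℘[L - (0 : ℂ)] 0 := L.analyticAt_weierstrassPExcept 0
  have a2 : AnalyticAt ℂ ℘'[L - (0 : ℂ)] 0 := L.analyticAt_derivWeierstrassPExcept 0
  have hid (k : ℕ) : tay (fun z => z ^ k) = X ^ k := by
    rw [tay_pow (f := fun z => z) (by fun_prop), tay_id]
  have e1 : tay (fun z => (℘'[L - (0 : ℂ)] z * z ^ 3 + (-2)) ^ 2) =
      (tay ℘'[L - (0 : ℂ)] * X ^ 3 + C (-2)) ^ 2 := by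
    rw [tay_pow (by fun_prop), tay_add (by fun_prop) (by fun_prop),
      tay_mul (by fun_prop) (by fun_prop), hid, tay_const]
  have e2 : tay (fun z => (℘[L - (0 : ℂ)] z * z ^ 2 + 1) ^ 3) =
      (tay ℘[L - (0 : ℂ)] * X ^ 2 + C 1) ^ 3 := by
    rw [tay_pow (by fun_prop), tay_add (by fun_prop) (by fun_prop),
      tay_mul (by fun_prop) (by fun_prop), hid, tay_const]
  have e3 : tay (fun z => ℘[L - (0 : ℂ)] z * z ^ 6 + z ^ 4) =
      tay ℘[L - (0 : ℂ)] * X ^ 6 + X ^ 4 := by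
    rw [tay_add (by fun_prop) (by fun_prop),
      tay_mul (by fun_prop) (by fun_prop), hid, hid]
  rw [tay_const, tay_add (by fun_prop) (by fun_prop), tay_add (by fun_prop) (by fun_prop),
    tay_add (by fun_prop) (by fun_prop), e1,
    tay_mul (f := fun _ => (-4 : ℂ)) (by fun_prop) (by fun_prop), e2,
    tay_mul (f := fun _ => L.g₂) (by fun_prop) (by fun_prop), e3,
    tay_mul (f := fun _ => L.g₃) (by fun_prop) (by fun_prop), hid,
    tay_const, tay_const, tay_const, tay_P, tay_P'] at h
  have c4 : C (4 : ℂ) = (4 : ℂ⟦X⟧) := map_ofNat (C (R := ℂ)) 4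
  have c2 : C (2 : ℂ) = (2 : ℂ⟦X⟧) := map_ofNat (C (R := ℂ)) 2
  rw [map_neg, map_neg, c2, c4, map_one, map_zero] at h
  have h6 := tay_P L
  linear_combination h - C L.g₂ * X ^ 4 * h6

lemma coeff_mul_mem (B : Subalgebra ℚ ℂ) {f g : ℂ⟦X⟧} {k : ℕ} (hf0 : coeff 0 f = 0)
    (hg0 : coeff 0 g = 0) (hf : ∀ j < k, coeff j f ∈ B) (hg : ∀ j < k, coeff j g ∈ B) :
    ∀ j ≤ k, coeff j (f * g) ∈ B := by
  intro j hj
  rw [PowerSeries.coeff_mul]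
  refine sum_mem fun p hp => ?_
  have hp := Finset.HasAntidiagonal.mem_antidiagonal.1 hp
  rcases Nat.eq_zero_or_pos p.1 with h | h
  · rw [h, hf0, zero_mul]; exact zero_mem _
  rcases Nat.eq_zero_or_pos p.2 with h' | h'
  · rw [h', hg0, mul_zero]; exact zero_mem _
  exact mul_mem (hf _ (by omega)) (hg _ (by omega))

lemma rat_mem (B : Subalgebra ℚ ℂ) (c : ℚ) : (c : ℂ) ∈ B := B.algebraMap_mem c

lemma gg_mem (L : PeriodPair) (B : Subalgebra ℚ ℂ) (h4 : L.G 4 ∈ B) (h6 : L.G 6 ∈ B) (k : ℕ) :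
    gg L k ∈ B := by
  induction k using Nat.strong_induction_on with
  | _ k ih =>
  by_cases hk : k < 3
  · simp [gg, hk]
  have U0 : coeff 0 (UUs L) = 0 := by simp [UUs, gg]
  have W0 : coeff 0 (WWs L) = 0 := by simp [WWs, gg]
  have hU : ∀ j < k, coeff j (UUs L) ∈ B := fun j hj => by
    simp only [UUs, coeff_mk]
    refine mul_mem ?_ (ih j hj)
    simpa using rat_mem B (j - 1)
  have hW : ∀ j < k, coeff j (WWs L) ∈ B := fun j hj => by
    simp only [WWs, coeff_mk]
    refine mul_mem ?_ (ih j hj)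
    simpa using rat_mem B ((j - 1) * (j - 2))
  have hUU := coeff_mul_mem B U0 U0 hU hU
  have hWW := coeff_mul_mem B W0 W0 hW hW
  have hUUU := coeff_mul_mem B (f := UUs L) (g := UUs L * UUs L) U0 (by simp [PowerSeries.coeff_mul, U0, -PowerSeries.coeff_zero_eq_constantCoeff]) hU
    (fun j hj => hUU j hj.le)
  have g2 : L.g₂ ∈ B := by
    simpa [PeriodPair.g₂] using mul_mem (rat_mem B 60) h4
  have g3 : L.g₃ ∈ B := by
    simpa [PeriodPair.g₃] using mul_mem (rat_mem B 140) h6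
  have hX : ∀ n : ℕ, coeff k (X ^ n : ℂ⟦X⟧) ∈ B := fun n => by
    rw [PowerSeries.coeff_X_pow]; split_ifs
    · exact one_mem _
    · exact zero_mem _
  have hUX : coeff k (UUs L * X ^ 4) ∈ B := by
    rw [PowerSeries.coeff_mul_X_pow']
    split_ifs
    · exact hU _ (by omega)
    · exact zero_mem _
  have key : C (4 : ℂ) * WWs L + C (12 : ℂ) * UUs L = WWs L * WWs L - C (4 : ℂ) * (UUs L * (UUs L * UUs L)) -
      C (12 : ℂ) * (UUs L * UUs L) + C L.g₂ * (UUs L * X ^ 4) + C L.g₂ * X ^ 4 + C L.g₃ * X ^ 6 := by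
    have c4 : C (4 : ℂ) = (4 : ℂ⟦X⟧) := map_ofNat (C (R := ℂ)) 4
    have c12 : C (12 : ℂ) = (12 : ℂ⟦X⟧) := map_ofNat (C (R := ℂ)) 12
    rw [c4, c12]
    linear_combination - series_identity L
  have hk' := congrArg (coeff k) key
  have hmem : coeff k (C (4 : ℂ) * WWs L + C (12 : ℂ) * UUs L) ∈ B := by
    rw [hk']
    have m4 : (4 : ℂ) ∈ B := by simpa using rat_mem B 4
    have m12 : (12 : ℂ) ∈ B := by simpa using rat_mem B 12
    simp only [map_add, map_sub, PowerSeries.coeff_C_mul]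
    exact add_mem (add_mem (add_mem (sub_mem (sub_mem (hWW k le_rfl) (mul_mem m4 (hUUU k le_rfl)))
      (mul_mem m12 (hUU k le_rfl))) (mul_mem g2 hUX)) (mul_mem g2 (hX 4))) (mul_mem g3 (hX 6))
  have hval : coeff k (C (4 : ℂ) * WWs L + C (12 : ℂ) * UUs L) =
      (4 * (k - 1) * (k + 1) : ℚ) • gg L k := by
    simp only [UUs, WWs, map_add, PowerSeries.coeff_C_mul, coeff_mk, Algebra.smul_def]
    simp
    ring
  rw [hval] at hmem
  have hk3 : (3 : ℚ) ≤ k := by exact_mod_cast not_lt.1 hk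
  have hne : (4 * (k - 1) * (k + 1) : ℚ) ≠ 0 := by
    have : (k : ℚ) - 1 ≠ 0 := by linarith
    positivity
  have := B.smul_mem hmem (4 * (k - 1) * (k + 1) : ℚ)⁻¹
  rwa [smul_smul, inv_mul_cancel₀ hne, one_smul] at this

lemma LG_eq (L : PeriodPair) (τ : ℂ) (h1 : L.ω₁ = 1) (h2 : L.ω₂ = τ) {k : ℕ} (hk : 3 ≤ k) :
    L.G k = G k τ := by
  have hs := (L.hasSum_sumInvPow 0 (r := k) (by omega)).summable
  rw [G_eq_TT (by omega)]
  have hs' := (L.latticeEquivProd.symm.toEquiv.summable_iff).2 hs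
  rw [PeriodPair.G, ← L.latticeEquivProd.symm.toEquiv.tsum_eq]
  have e (x : ℤ × ℤ) : (L.latticeEquivProd.symm.toEquiv x : ℂ) = x.1 + x.2 * τ := by
    have := L.latticeEquiv_symm_apply x
    rw [h1, h2, mul_one] at this
    exact this
  simp only [Function.comp_def, sub_zero, e] at hs' ⊢
  rw [hs'.tsum_prod]
  simp [TT]

lemma G_mem {τ : ℂ} (hτ : 0 < τ.im) (B : Subalgebra ℚ ℂ) (h4 : G 4 τ ∈ B) (h6 : G 6 τ ∈ B)
    {k : ℕ} (hk : 3 ≤ k) : G k τ ∈ B := by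
  have hind : LinearIndependent ℝ ![(1 : ℂ), τ] := by
    rw [LinearIndependent.pair_iff]
    intro s t h
    have h1 := congrArg Complex.im h
    have h2 := congrArg Complex.re h
    simp at h1 h2
    rcases h1 with h1 | h1
    · subst h1; simpa using h2
    · exact absurd h1 hτ.ne'
  let L : PeriodPair := ⟨1, τ, hind⟩
  have e {k : ℕ} (hk : 3 ≤ k) : L.G k = G k τ := LG_eq L τ rfl rfl hk
  have := gg_mem L B (by rwa [e (by norm_num)]) (by rwa [e (by norm_num)]) k
  rwa [gg, if_neg (by omega), e hk] at this

end Weier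

theorem tildeG_polynomial (p q : ℕ) (hp : 1 ≤ p) (hq : 1 ≤ q)
    (hpq : (p, q) ≠ (1, 1)) (τ : ℂ) (hτ : 0 < τ.im) :
    ∃ P : MvPolynomial (Fin 5) ℚ,
      τ ^ (2 * (p + q)) * tildeG p q τ =
        MvPolynomial.aeval ![τ ^ 2, (π : ℂ) ^ 2, G 2 τ, G 4 τ, G 6 τ] P := by
  obtain ⟨a, rfl⟩ : ∃ a, p = a + 1 := ⟨p - 1, by omega⟩
  obtain ⟨b, rfl⟩ : ∃ b, q = b + 1 := ⟨q - 1, by omega⟩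
  have h : τ ^ (2 * (a + 1 + (b + 1))) * tildeG (a + 1) (b + 1) τ ∈
      Algebra.adjoin ℚ (Set.range ![τ ^ 2, (π : ℂ) ^ 2, G 2 τ, G 4 τ, G 6 τ]) := by
    have hgen (i : Fin 5) : ![τ ^ 2, (π : ℂ) ^ 2, G 2 τ, G 4 τ, G 6 τ] i ∈
        Algebra.adjoin ℚ (Set.range ![τ ^ 2, (π : ℂ) ^ 2, G 2 τ, G 4 τ, G 6 τ]) :=
      Algebra.subset_adjoin ⟨i, rfl⟩
    generalize Algebra.adjoin ℚ (Set.range ![τ ^ 2, (π : ℂ) ^ 2, G 2 τ, G 4 τ, G 6 τ]) = B at hgen ⊢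
    have ht : τ ^ 2 ∈ B := hgen 0
    have hπ : (π : ℂ) ^ 2 ∈ B := hgen 1
    have h2 : G 2 τ ∈ B := hgen 2
    have h4 : G 4 τ ∈ B := hgen 3
    have h6 : G 6 τ ∈ B := hgen 4
    have hZ (j : ℕ) : ZZ (2 * j + 2) ∈ B := by
      obtain ⟨c, hc⟩ := ZZ_eq j
      rw [hc]
      exact mul_mem (rat_mem B c) (pow_mem hπ _)
    obtain ⟨c, hc⟩ := tildeG_eq_s15 a b hτ
    rw [hc]
    refine add_mem (mul_mem (hZ a) (hZ b)) (sum_mem fun i hi => ?_)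
    obtain ⟨d, hd⟩ := KK_mul a b i (Finset.mem_range.1 hi)
    rw [hd, mul_assoc, mul_assoc, G_eq_s15 i hτ, show τ ^ (2 * i + 2) = (τ ^ 2) ^ (i + 1) by ring]
    refine mul_mem (rat_mem B _) (mul_mem (mul_mem (rat_mem B _) (pow_mem hπ _))
      (sub_mem (mul_mem (pow_mem ht _) ?_) (hZ i)))
    rcases Nat.eq_zero_or_pos i with rfl | hi
    · exact h2
    · exact G_mem hτ B h4 h6 (by omega)
  rw [Algebra.adjoin_range_eq_range_aeval] at h
  obtain ⟨P, hP⟩ := h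
  exact ⟨P, hP.symm⟩
end
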